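/- arXiv:2406.14311 — 3 statements merged into one kernel-verified Lean document; each statement's English description precedes it below -/
import Mathlib

section
/- Let m ≥ 2 and let Q and Q′ be two quadrangulations of the alternately 2-colored convex 2m-gon, i.e. two decompositions of the polygon into quadrilaterals obtained by choosing m−2 pairwise non-crossing diagonals, each connecting a black vertex to a blue vertex. Then Q can be transformed into Q′ by a finite sequence of edge switches; equivalently, the flip graph whose vertices are the quadrangulations of the bicolored 2m-gon and whose edges are edge switches is connected. (This is the paper's rectangulation lemma, Section 2.3.) -/
/-!
Statement 1: any two quadrangulations of the alternately 2-colored convex `2m`-gon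
are connected by a finite sequence of edge switches (flips): the flip graph on
quadrangulations is connected.
-/

/-- `x` lies strictly between `a` and `b` in the cyclic (counterclockwise) order. -/
def CBtw {n : ℕ} (a x b : ZMod n) : Prop :=
  0 < (x - a).val ∧ (x - a).val < (b - a).val

/-- `e` is a diagonal of the convex polygon with vertex set `ZMod (2*m)`:
its endpoints are distinct and not cyclically adjacent. -/
def IsDiag (m : ℕ) (e : Sym2 (ZMod (2 * m))) : Prop :=
  ∃ i j : ZMod (2 * m), e = s(i, j) ∧ i ≠ j ∧ j ≠ i + 1 ∧ i ≠ j + 1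

/-- `e` is bicolored: its endpoints have opposite parity (one black, one blue). -/
def IsBicolored (m : ℕ) (e : Sym2 (ZMod (2 * m))) : Prop :=
  ∃ i j : ZMod (2 * m), e = s(i, j) ∧ (Even i.val ↔ ¬ Even j.val)

/-- A bicolored diagonal. -/
def IsBicolDiag (m : ℕ) (e : Sym2 (ZMod (2 * m))) : Prop :=
  IsDiag m e ∧ IsBicolored m e

/-- Two diagonals cross: one endpoint of `f` lies strictly inside the open arc from `a`
to `b` and the other strictly inside the open arc from `b` to `a`. -/
def Cross (m : ℕ) (e f : Sym2 (ZMod (2 * m))) : Prop :=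
  ∃ a b c d : ZMod (2 * m), e = s(a, b) ∧ f = s(c, d) ∧ CBtw a c b ∧ CBtw b d a

/-- A quadrangulation: `m - 2` pairwise non-crossing bicolored diagonals. -/
def IsQuadrangulation (m : ℕ) (Q : Finset (Sym2 (ZMod (2 * m)))) : Prop :=
  (∀ e ∈ Q, IsBicolDiag m e) ∧ (∀ e ∈ Q, ∀ f ∈ Q, ¬ Cross m e f) ∧ Q.card = m - 2

/-- An edge switch (flip) between two quadrangulations: remove one diagonal `e` of `Q`
and insert a new diagonal `e' ∉ Q`, obtaining again a quadrangulation. -/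
def FlipStep (m : ℕ) (Q Q' : Finset (Sym2 (ZMod (2 * m)))) : Prop :=
  IsQuadrangulation m Q ∧ IsQuadrangulation m Q' ∧
    ∃ e e', e ∈ Q ∧ e' ∉ Q ∧ Q' = insert e' (Q.erase e)

/-- Ternary trees; a tree with `n` nodes is the dual tree of a quadrangulation of a
`(2 * n + 2)`-gon with a marked boundary edge. -/
inductive TernaryTree : Type
  | leaf : TernaryTree
  | node : TernaryTree → TernaryTree → TernaryTree → TernaryTree

namespace TernaryTree

/-- The number of internal nodes. -/
def size : TernaryTree → ℕ
  | leaf => 0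
  | node A B C => A.size + B.size + C.size + 1

/-- The number of leaves. -/
def width : TernaryTree → ℕ
  | leaf => 1
  | node A B C => A.width + B.width + C.width

/-- The intervals spanned by the internal nodes when the leaves are the unit intervals
`[a, a + 1]`, `[a + 1, a + 2]`, …. -/
def chords : TernaryTree → ℕ → Finset (ℕ × ℕ)
  | leaf, _ => ∅
  | node A B C, a => insert (a, a + (A.width + B.width + C.width))
      (A.chords a ∪ B.chords (a + A.width) ∪ C.chords (a + A.width + B.width))

theorem width_eq (t : TernaryTree) : t.width = 2 * t.size + 1 := by
  induction t with
  | leaf => rfl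
  | node A B C hA hB hC => simp only [width, size]; omega

theorem bounds_of_mem_chords {t : TernaryTree} {a i j : ℕ} (h : (i, j) ∈ t.chords a) :
    a ≤ i ∧ i + 3 ≤ j ∧ j ≤ a + t.width ∧ (i + j) % 2 = 1 := by
  induction t generalizing a with
  | leaf => simp [chords] at h
  | node A B C hA hB hC =>
    have := A.width_eq
    have := B.width_eq
    have := C.width_eq
    simp only [chords, Finset.mem_insert, Finset.mem_union, Prod.mk.injEq] at h
    simp only [width]
    rcases h with ⟨rfl, rfl⟩ | (h | h) | h
    · omega
    · have := hA h; omega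
    · have := hB h; omega
    · have := hC h; omega

theorem not_cross_of_mem_chords {t : TernaryTree} {a i j k l : ℕ} (h : (i, j) ∈ t.chords a)
    (h' : (k, l) ∈ t.chords a) : ¬ (i < k ∧ k < j ∧ j < l) := by
  induction t generalizing a with
  | leaf => simp [chords] at h
  | node A B C hA hB hC =>
    have b := bounds_of_mem_chords h
    have b' := bounds_of_mem_chords h'
    simp only [chords, Finset.mem_insert, Finset.mem_union, Prod.mk.injEq] at h h'
    simp only [width] at b b'
    rcases h with h | (h | h) | h <;> rcases h' with h' | (h' | h') | h' <;>
      first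
      | exact hA h h'
      | exact hB h h'
      | exact hC h h'
      | omega
      | (have := bounds_of_mem_chords h; have := bounds_of_mem_chords h'; omega)

theorem card_chords (t : TernaryTree) (a : ℕ) : (t.chords a).card = t.size := by
  induction t generalizing a with
  | leaf => rfl
  | node A B C hA hB hC =>
    have := A.width_eq
    have := B.width_eq
    have := C.width_eq
    rw [chords, Finset.card_insert_of_notMem, Finset.card_union_of_disjoint,
      Finset.card_union_of_disjoint, hA, hB, hC, size]
    · rw [Finset.disjoint_left]
      rintro ⟨i, j⟩ h h'
      have := bounds_of_mem_chords h
      have := bounds_of_mem_chords h'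
      omega
    · rw [Finset.disjoint_left]
      rintro ⟨i, j⟩ h h'
      have := bounds_of_mem_chords h'
      rcases Finset.mem_union.1 h with h | h <;> have := bounds_of_mem_chords h <;> omega
    · simp only [Finset.mem_union]
      rintro ((h | h) | h) <;> have := bounds_of_mem_chords h <;> omega

/-- Every non-crossing family of odd intervals of length at least `3` extends to the family of
intervals of a ternary tree. -/
theorem exists_subset_chords (n : ℕ) : ∀ (a : ℕ) (S : Finset (ℕ × ℕ)),
    (∀ i j, (i, j) ∈ S → a ≤ i ∧ i + 3 ≤ j ∧ j ≤ a + (2 * n + 1) ∧ (i + j) % 2 = 1) →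
    (∀ i j k l, (i, j) ∈ S → (k, l) ∈ S → ¬ (i < k ∧ k < j ∧ j < l)) →
    ∃ t : TernaryTree, t.size = n ∧ S ⊆ t.chords a := by
  induction n using Nat.strong_induction_on with
  | _ n ih =>
  intro a S hS hc
  rcases Nat.eq_zero_or_pos n with rfl | hn
  · refine ⟨leaf, rfl, ?_⟩
    rintro ⟨i, j⟩ h
    have := hS i j h
    omega
  set b := a + (2 * n + 1) with hb
  obtain ⟨x, hx, hxmax⟩ : ∃ x, (x < b ∧ (a + x) % 2 = 1 ∧ a < x ∧ (x = a + 1 ∨ (a, x) ∈ S)) ∧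
      ∀ d, (a, d) ∈ S → d ≠ b → d ≤ x := by
    obtain ⟨x, hx, hmax⟩ := Finset.exists_max_image
      ((Finset.range b).filter fun x => x = a + 1 ∨ (a, x) ∈ S) id
      ⟨a + 1, by simp; omega⟩
    simp only [Finset.mem_filter, Finset.mem_range, id] at hx hmax
    refine ⟨x, ⟨hx.1, ?_, ?_, hx.2⟩, fun d hd hne => hmax d ⟨?_, Or.inr hd⟩⟩
    · rcases hx.2 with h | h
      · omega
      · exact (hS _ _ h).2.2.2
    · rcases hx.2 with h | h
      · omega
      · have := hS _ _ h; omega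
    · have := hS _ _ hd; omega
  obtain ⟨y, hy, hymin⟩ : ∃ y, (a < y ∧ (y + b) % 2 = 1 ∧ y < b ∧ (y = b - 1 ∨ (y, b) ∈ S)) ∧
      ∀ c, (c, b) ∈ S → c ≠ a → y ≤ c := by
    obtain ⟨y, hy, hmin⟩ := Finset.exists_min_image
      ((Finset.Ioo a b).filter fun y => y = b - 1 ∨ (y, b) ∈ S) id
      ⟨b - 1, by simp; omega⟩
    simp only [Finset.mem_filter, Finset.mem_Ioo, id] at hy hmin
    refine ⟨y, ⟨hy.1.1, ?_, hy.1.2, hy.2⟩, fun d hd hne => hmin d ⟨?_, Or.inr hd⟩⟩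
    · rcases hy.2 with h | h
      · omega
      · exact (hS _ _ h).2.2.2
    · have := hS _ _ hd; omega
  have hxy : x < y := by
    rcases hx.2.2.2 with h | h
    · omega
    · rcases hy.2.2.2 with h' | h'
      · omega
      · have := hc _ _ _ _ h h'; omega
  have key : ∀ c d n', c < d → d = c + (2 * n' + 1) → n' < n → ∃ t : TernaryTree,
      t.size = n' ∧ (S.filter fun p => c ≤ p.1 ∧ p.2 ≤ d) ⊆ t.chords c := by
    intro c d n' hcd hd hn'
    refine ih n' hn' c _ ?_ ?_
    · intro i j h
      rw [Finset.mem_filter] at h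
      have := hS i j h.1
      have := h.2
      simp only at this
      omega
    · intro i j k l h h'
      exact hc i j k l (Finset.mem_filter.1 h).1 (Finset.mem_filter.1 h').1
  obtain ⟨A, hA, hAS⟩ := key a x ((x - a) / 2) (by omega) (by omega) (by omega)
  obtain ⟨B, hB, hBS⟩ := key x y ((y - x) / 2) (by omega) (by omega) (by omega)
  obtain ⟨C, hC, hCS⟩ := key y b ((b - y) / 2) (by omega) (by omega) (by omega)
  refine ⟨node A B C, by simp only [size]; omega, ?_⟩
  have wA := A.width_eq
  have wB := B.width_eq
  have wC := C.width_eq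
  rintro ⟨i, j⟩ h
  have hij := hS i j h
  have e1 : a + A.width = x := by omega
  have e2 : x + B.width = y := by omega
  have e3 : a + (A.width + B.width + C.width) = b := by omega
  simp only [chords, e1, e2, e3, Finset.mem_insert, Finset.mem_union, Prod.mk.injEq]
  by_cases hr : i = a ∧ j = b
  · exact Or.inl hr
  have h1 : ¬ (i < x ∧ x < j) := by
    rintro ⟨hi, hj⟩
    rcases Nat.eq_or_lt_of_le hij.1 with rfl | hlt
    · have := hxmax j h (by omega)
      omega
    · rcases hx.2.2.2 with h' | h'
      · omega
      · exact hc _ _ _ _ h' h ⟨hlt, hi, hj⟩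
  have h2 : ¬ (i < y ∧ y < j) := by
    rintro ⟨hi, hj⟩
    rcases Nat.eq_or_lt_of_le hij.2.2.1 with rfl | hlt
    · have := hymin i h (by omega)
      omega
    · rcases hy.2.2.2 with h' | h'
      · omega
      · exact hc _ _ _ _ h h' ⟨hi, hj, hlt⟩
  right
  rcases Nat.lt_or_ge x j with hj | hj
  · rcases Nat.lt_or_ge y j with hj' | hj'
    · exact Or.inr (hCS (Finset.mem_filter.2 ⟨h, by simp only; omega⟩))
    · exact Or.inl (Or.inr (hBS (Finset.mem_filter.2 ⟨h, by simp only; omega⟩)))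
  · exact Or.inl (Or.inl (hAS (Finset.mem_filter.2 ⟨h, by simp only; omega⟩)))

/-- Rotations towards the leftmost branch. -/
inductive Rotation : TernaryTree → TernaryTree → Prop
  | middle (A B₁ B₂ B₃ C) : Rotation (node A (node B₁ B₂ B₃) C) (node (node A B₁ B₂) B₃ C)
  | right (A B C₁ C₂ C₃) : Rotation (node A B (node C₁ C₂ C₃)) (node (node A B C₁) C₂ C₃)
  | left {A A'} (B C) : Rotation A A' → Rotation (node A B C) (node A' B C)

theorem Rotation.size_eq {t t' : TernaryTree} (h : Rotation t t') : t'.size = t.size := by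
  induction h with
  | middle | right => simp only [size]; omega
  | left _ _ _ ih => simp only [size, ih]

theorem Rotation.exists_chords_eq_insert {t t' : TernaryTree} (h : Rotation t t') (a : ℕ) :
    ∃ e e' U, t.chords a = insert e U ∧ t'.chords a = insert e' U := by
  induction h with
  | middle A B₁ B₂ B₃ C =>
    refine ⟨(a + A.width, a + A.width + B₁.width + B₂.width + B₃.width),
      (a, a + A.width + B₁.width + B₂.width),
      insert (a, a + A.width + B₁.width + B₂.width + B₃.width + C.width)
        (A.chords a ∪ B₁.chords (a + A.width) ∪ B₂.chords (a + A.width + B₁.width) ∪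
          B₃.chords (a + A.width + B₁.width + B₂.width) ∪
          C.chords (a + A.width + B₁.width + B₂.width + B₃.width)), ?_, ?_⟩ <;>
    · simp only [chords, width, ← add_assoc]
      ext p
      simp only [Finset.mem_insert, Finset.mem_union]
      tauto
  | right A B C₁ C₂ C₃ =>
    refine ⟨(a + A.width + B.width, a + A.width + B.width + C₁.width + C₂.width + C₃.width),
      (a, a + A.width + B.width + C₁.width),
      insert (a, a + A.width + B.width + C₁.width + C₂.width + C₃.width)
        (A.chords a ∪ B.chords (a + A.width) ∪ C₁.chords (a + A.width + B.width) ∪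
          C₂.chords (a + A.width + B.width + C₁.width) ∪
          C₃.chords (a + A.width + B.width + C₁.width + C₂.width)), ?_, ?_⟩ <;>
    · simp only [chords, width, ← add_assoc]
      ext p
      simp only [Finset.mem_insert, Finset.mem_union]
      tauto
  | @left A A' B C h ih =>
    obtain ⟨e, e', U, h1, h2⟩ := ih
    have hw : A'.width = A.width := by rw [width_eq, width_eq, h.size_eq]
    refine ⟨e, e', insert (a, a + (A.width + B.width + C.width))
      (U ∪ B.chords (a + A.width) ∪ C.chords (a + A.width + B.width)), ?_, ?_⟩ <;>
    · simp only [chords, h1, h2, hw]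
      ext p
      simp only [Finset.mem_insert, Finset.mem_union]
      tauto

/-- The tree whose internal nodes form a leftmost path. -/
def leftComb : ℕ → TernaryTree
  | 0 => leaf
  | n + 1 => node (leftComb n) leaf leaf

theorem exists_rotations_node_leaf_leaf (n : ℕ) : ∀ A B C : TernaryTree, B.size + C.size = n →
    ∃ A' : TernaryTree, A'.size = A.size + n ∧
      Relation.ReflTransGen Rotation (node A B C) (node A' leaf leaf) := by
  induction n using Nat.strong_induction_on with
  | _ n ih =>
  intro A B C hn
  match B, C with
  | node B₁ B₂ B₃, C =>
    simp only [size] at hn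
    obtain ⟨A', h, hr⟩ := ih (B₃.size + C.size) (by omega) (node A B₁ B₂) B₃ C rfl
    exact ⟨A', by simp only [size] at h; omega, .head (.middle A B₁ B₂ B₃ C) hr⟩
  | leaf, node C₁ C₂ C₃ =>
    simp only [size] at hn
    obtain ⟨A', h, hr⟩ := ih (C₂.size + C₃.size) (by omega) (node A leaf C₁) C₂ C₃ rfl
    exact ⟨A', by simp only [size] at h; omega, .head (.right A leaf C₁ C₂ C₃) hr⟩
  | leaf, leaf => exact ⟨A, by simp only [size] at hn; omega, .refl⟩

theorem rotations_leftComb (n : ℕ) : ∀ t : TernaryTree, t.size = n →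
    Relation.ReflTransGen Rotation t (leftComb n) := by
  induction n with
  | zero =>
    intro t ht
    cases t with
    | leaf => exact .refl
    | node A B C => simp [size] at ht
  | succ n ih =>
    intro t ht
    cases t with
    | leaf => simp [size] at ht
    | node A B C =>
      obtain ⟨A', h, hr⟩ := exists_rotations_node_leaf_leaf _ A B C rfl
      simp only [size] at ht
      exact hr.trans ((ih A' (by omega)).lift (fun A => node A leaf leaf)
        fun _ _ h => .left leaf leaf h)

end TernaryTree

theorem cBtw_iff_val {n : ℕ} [NeZero n] (a x b : ZMod n) :
    CBtw a x b ↔ (a.val < x.val ∧ x.val < b.val) ∨ (b.val < a.val ∧ a.val < x.val) ∨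
      (x.val < b.val ∧ b.val < a.val) := by
  have sub_val : ∀ u v : ZMod n,
      (u - v).val = if v.val ≤ u.val then u.val - v.val else u.val + n - v.val := by
    intro u v
    split_ifs with h
    · exact ZMod.val_sub h
    · have hu := u.val_lt
      have hv := v.val_lt
      have e : u - v = ((u.val + n - v.val : ℕ) : ZMod n) := by
        rw [Nat.cast_sub (by omega)]
        simp
      rw [e, ZMod.val_cast_of_lt (by omega)]
  have ha := a.val_lt
  have hb := b.val_lt
  have hx := x.val_lt
  rw [CBtw, sub_val, sub_val]
  split_ifs <;> omega

/-- The chord of the `2 * m`-gon joining two vertices given by natural numbers. -/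
def natChord (m : ℕ) (p : ℕ × ℕ) : Sym2 (ZMod (2 * m)) := s((p.1 : ZMod (2 * m)), p.2)

section natChord

variable {m i j k l : ℕ}

theorem natChord_inj (hij : i < j) (hj : j < 2 * m) (hkl : k < l) (hl : l < 2 * m)
    (h : natChord m (i, j) = natChord m (k, l)) : i = k ∧ j = l := by
  simp only [natChord, Sym2.eq_iff] at h
  have vi := ZMod.val_cast_of_lt (show i < 2 * m by omega)
  have vj := ZMod.val_cast_of_lt hj
  have vk := ZMod.val_cast_of_lt (show k < 2 * m by omega)
  have vl := ZMod.val_cast_of_lt hl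
  rcases h with ⟨h1, h2⟩ | ⟨h1, h2⟩ <;> rw [h1] at vi <;> rw [h2] at vj <;> omega

theorem cross_natChord_iff (hij : i < j) (hj : j < 2 * m) (hkl : k < l) (hl : l < 2 * m) :
    Cross m (natChord m (i, j)) (natChord m (k, l)) ↔
      (i < k ∧ k < j ∧ j < l) ∨ (k < i ∧ i < l ∧ l < j) := by
  have : NeZero (2 * m) := ⟨by omega⟩
  have vi := ZMod.val_cast_of_lt (show i < 2 * m by omega)
  have vj := ZMod.val_cast_of_lt hj
  have vk := ZMod.val_cast_of_lt (show k < 2 * m by omega)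
  have vl := ZMod.val_cast_of_lt hl
  constructor
  · rintro ⟨a, b, c, d, he, hf, h1, h2⟩
    rw [cBtw_iff_val] at h1 h2
    simp only [natChord, Sym2.eq_iff] at he hf
    rcases he with ⟨rfl, rfl⟩ | ⟨rfl, rfl⟩ <;> rcases hf with ⟨rfl, rfl⟩ | ⟨rfl, rfl⟩ <;>
      rw [vi, vj, vk] at * <;> rw [vl] at * <;> omega
  · rintro (h | h)
    · refine ⟨i, j, k, l, rfl, rfl, ?_, ?_⟩ <;> rw [cBtw_iff_val] <;> omega
    · refine ⟨i, j, l, k, rfl, Sym2.eq_swap, ?_, ?_⟩ <;> rw [cBtw_iff_val] <;> omega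

theorem isBicolDiag_natChord_iff (hij : i < j) (hj : j < 2 * m) :
    IsBicolDiag m (natChord m (i, j)) ↔
      (i + j) % 2 = 1 ∧ i + 3 ≤ j ∧ ¬ (i = 0 ∧ j = 2 * m - 1) := by
  have : NeZero (2 * m) := ⟨by omega⟩
  have vi := ZMod.val_cast_of_lt (show i < 2 * m by omega)
  have vj := ZMod.val_cast_of_lt hj
  have hsucc : ∀ u v : ℕ, u < 2 * m → v < 2 * m →
      ((v : ZMod (2 * m)) = u + 1 ↔ v = u + 1 ∨ (v = 0 ∧ u + 1 = 2 * m)) := by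
    intro u v hu hv
    have vv := ZMod.val_cast_of_lt hv
    rcases Nat.lt_or_ge (u + 1) (2 * m) with h | h
    · rw [← ZMod.val_injective _ |>.eq_iff, vv, ← Nat.cast_succ, ZMod.val_cast_of_lt h]
      omega
    · have e : u + 1 = 2 * m := by omega
      rw [← ZMod.val_injective _ |>.eq_iff, vv, ← Nat.cast_succ, Nat.succ_eq_add_one, e,
        ZMod.natCast_self, ZMod.val_zero]
      omega
  have hne : (i : ZMod (2 * m)) ≠ j := by
    intro h
    rw [h] at vi
    omega
  have hd : IsDiag m (natChord m (i, j)) ↔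
      ¬ (j : ZMod (2 * m)) = i + 1 ∧ ¬ (i : ZMod (2 * m)) = j + 1 := by
    constructor
    · rintro ⟨a, b, he, -, h1, h2⟩
      simp only [natChord, Sym2.eq_iff] at he
      rcases he with ⟨rfl, rfl⟩ | ⟨rfl, rfl⟩
      exacts [⟨h1, h2⟩, ⟨h2, h1⟩]
    · exact fun h => ⟨i, j, rfl, hne, h.1, h.2⟩
  have hb : IsBicolored m (natChord m (i, j)) ↔ (i + j) % 2 = 1 := by
    constructor
    · rintro ⟨a, b, he, h⟩
      simp only [natChord, Sym2.eq_iff] at he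
      rcases he with ⟨rfl, rfl⟩ | ⟨rfl, rfl⟩ <;>
        rw [vi, vj, Nat.even_iff, Nat.even_iff] at h <;> omega
    · intro h
      refine ⟨i, j, rfl, ?_⟩
      rw [vi, vj, Nat.even_iff, Nat.even_iff]
      omega
  rw [IsBicolDiag, hd, hb, hsucc i j (by omega) hj, hsucc j i hj (by omega)]
  omega

theorem exists_natChord_eq {e : Sym2 (ZMod (2 * m))} (hm : 0 < m) (he : IsDiag m e) :
    ∃ i j, i < j ∧ j < 2 * m ∧ natChord m (i, j) = e := by
  have : NeZero (2 * m) := ⟨by omega⟩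
  obtain ⟨a, b, rfl, hne, -⟩ := he
  rcases lt_trichotomy a.val b.val with h | h | h
  · exact ⟨a.val, b.val, h, b.val_lt, by simp [natChord]⟩
  · exact absurd (ZMod.val_injective _ h) hne
  · exact ⟨b.val, a.val, h, a.val_lt, by simp [natChord, Sym2.eq_swap]⟩

end natChord

/-- The diagonals of the `2 * m`-gon dual to a ternary tree with `m - 1` nodes; the root
corresponds to the boundary edge joining `0` and `2 * m - 1`. -/
def TernaryTree.diagonals (m : ℕ) (t : TernaryTree) : Finset (Sym2 (ZMod (2 * m))) :=
  ((t.chords 0).erase (0, 2 * m - 1)).image (natChord m)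

theorem TernaryTree.isQuadrangulation_diagonals {m : ℕ} (hm : 2 ≤ m) {t : TernaryTree}
    (ht : t.size = m - 1) : IsQuadrangulation m (t.diagonals m) := by
  have hw := t.width_eq
  have hmem : (0, 2 * m - 1) ∈ t.chords 0 := by
    cases t with
    | leaf => simp only [size] at ht; omega
    | node A B C =>
      simp only [width] at hw
      simp only [chords, Finset.mem_insert, Prod.mk.injEq]
      exact Or.inl ⟨trivial, by omega⟩
  refine ⟨?_, ?_, ?_⟩
  · intro e he
    obtain ⟨⟨i, j⟩, h, rfl⟩ := Finset.mem_image.1 he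
    rw [Finset.mem_erase, Ne, Prod.mk.injEq] at h
    have := bounds_of_mem_chords h.2
    rw [isBicolDiag_natChord_iff (by omega) (by omega)]
    exact ⟨this.2.2.2, this.2.1, h.1⟩
  · intro e he f hf
    obtain ⟨⟨i, j⟩, h, rfl⟩ := Finset.mem_image.1 he
    obtain ⟨⟨k, l⟩, h', rfl⟩ := Finset.mem_image.1 hf
    have h := Finset.mem_of_mem_erase h
    have h' := Finset.mem_of_mem_erase h'
    have := bounds_of_mem_chords h
    have := bounds_of_mem_chords h'
    rw [cross_natChord_iff (by omega) (by omega) (by omega) (by omega)]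
    rintro (hx | hx)
    exacts [not_cross_of_mem_chords h h' hx, not_cross_of_mem_chords h' h hx]
  · rw [diagonals, Finset.card_image_of_injOn, Finset.card_erase_of_mem hmem, card_chords, ht]
    · omega
    · rintro ⟨i, j⟩ h ⟨k, l⟩ h' heq
      have := bounds_of_mem_chords (Finset.mem_of_mem_erase h)
      have := bounds_of_mem_chords (Finset.mem_of_mem_erase h')
      rw [Prod.mk.injEq]
      exact natChord_inj (by omega) (by omega) (by omega) (by omega) heq

theorem IsQuadrangulation.exists_diagonals_eq {m : ℕ} (hm : 2 ≤ m)
    {Q : Finset (Sym2 (ZMod (2 * m)))} (hQ : IsQuadrangulation m Q) :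
    ∃ t : TernaryTree, t.size = m - 1 ∧ t.diagonals m = Q := by
  classical
  obtain ⟨hdiag, hcross, hcard⟩ := hQ
  set S := (Finset.range (2 * m) ×ˢ Finset.range (2 * m)).filter
    fun p => p.1 < p.2 ∧ natChord m p ∈ Q with hS
  have mem_S : ∀ i j, (i, j) ∈ S ↔ i < j ∧ j < 2 * m ∧ natChord m (i, j) ∈ Q := by
    intro i j
    simp only [hS, Finset.mem_filter, Finset.mem_product, Finset.mem_range]
    constructor
    · tauto
    · rintro ⟨h1, h2, h3⟩
      exact ⟨⟨by omega, h2⟩, h1, h3⟩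
  have bounds : ∀ i j, (i, j) ∈ S →
      (i + j) % 2 = 1 ∧ i + 3 ≤ j ∧ j < 2 * m ∧ ¬ (i = 0 ∧ j = 2 * m - 1) := by
    intro i j h
    rw [mem_S] at h
    have := (isBicolDiag_natChord_iff h.1 h.2.1).1 (hdiag _ h.2.2)
    exact ⟨this.1, this.2.1, h.2.1, this.2.2⟩
  have image_S : S.image (natChord m) = Q := by
    ext e
    rw [Finset.mem_image]
    constructor
    · rintro ⟨⟨i, j⟩, h, rfl⟩
      exact ((mem_S i j).1 h).2.2
    · intro he
      obtain ⟨i, j, h1, h2, rfl⟩ := exists_natChord_eq (by omega) (hdiag e he).1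
      exact ⟨(i, j), (mem_S i j).2 ⟨h1, h2, he⟩, rfl⟩
  have card_S : S.card = m - 2 := by
    rw [← hcard, ← image_S, Finset.card_image_of_injOn]
    rintro ⟨i, j⟩ h ⟨k, l⟩ h' heq
    have h := (mem_S i j).1 h
    have h' := (mem_S k l).1 h'
    rw [Prod.mk.injEq]
    exact natChord_inj h.1 h.2.1 h'.1 h'.2.1 heq
  have root_notMem : (0, 2 * m - 1) ∉ S := fun h => (bounds _ _ h).2.2.2 ⟨rfl, rfl⟩
  obtain ⟨t, ht, hsub⟩ := TernaryTree.exists_subset_chords (m - 1) 0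
    (insert (0, 2 * m - 1) S) (by
      intro i j h
      rw [Finset.mem_insert, Prod.mk.injEq] at h
      rcases h with h | h
      · omega
      · have := bounds i j h
        omega) (by
      intro i j k l h h'
      rw [Finset.mem_insert, Prod.mk.injEq] at h h'
      rcases h with h | h
      · rcases h' with h' | h'
        · omega
        · have := bounds _ _ h'
          omega
      · rcases h' with h' | h'
        · omega
        · rw [mem_S] at h h'
          have := hcross _ h.2.2 _ h'.2.2
          rw [cross_natChord_iff h.1 h.2.1 h'.1 h'.2.1] at this
          tauto)
  have heq := Finset.eq_of_subset_of_card_le hsub (by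
    rw [TernaryTree.card_chords, Finset.card_insert_of_notMem root_notMem, card_S]
    omega)
  refine ⟨t, ht, ?_⟩
  rw [TernaryTree.diagonals, ← heq, Finset.erase_insert root_notMem, image_S]

theorem FlipStep.symm {m : ℕ} {Q Q' : Finset (Sym2 (ZMod (2 * m)))} (h : FlipStep m Q Q') :
    FlipStep m Q' Q := by
  obtain ⟨hQ, hQ', e, e', he, he', rfl⟩ := h
  refine ⟨hQ', hQ, e', e, Finset.mem_insert_self _ _, ?_, ?_⟩
  · rw [Finset.mem_insert]
    rintro (rfl | h)
    · exact he' he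
    · exact Finset.notMem_erase _ _ h
  · rw [Finset.erase_insert (fun h => he' (Finset.mem_of_mem_erase h)), Finset.insert_erase he]

theorem IsQuadrangulation.flipStep_or_eq {m : ℕ} {Q Q' U : Finset (Sym2 (ZMod (2 * m)))}
    {e e' : Sym2 (ZMod (2 * m))} (hQ : IsQuadrangulation m Q) (hQ' : IsQuadrangulation m Q')
    (hU : U ⊆ Q) (hU' : U ⊆ Q') (hQU : Q ⊆ insert e U) (hQU' : Q' ⊆ insert e' U) :
    FlipStep m Q Q' ∨ Q = Q' := by
  by_cases heq : Q = Q'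
  · exact Or.inr heq
  left
  have hcard : Q.card = Q'.card := hQ.2.2.trans hQ'.2.2.symm
  have not_sub : ¬ Q ⊆ Q' := fun h => heq (Finset.eq_of_subset_of_card_le h hcard.ge)
  have not_sub' : ¬ Q' ⊆ Q := fun h => heq (Finset.eq_of_subset_of_card_le h hcard.le).symm
  refine ⟨hQ, hQ', e, e', ?_, ?_, ?_⟩
  · by_contra he
    exact not_sub (((Finset.subset_insert_iff_of_notMem he).1 hQU).trans hU')
  · intro he
    exact not_sub' (hQU'.trans (Finset.insert_subset he hU))
  · have he : e ∉ Q' := fun he => not_sub (hQU.trans (Finset.insert_subset he hU'))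
    have he' : e' ∈ Q' := by
      by_contra he'
      exact not_sub' (((Finset.subset_insert_iff_of_notMem he').1 hQU').trans hU)
    have : Q.erase e = U := by
      refine (Finset.subset_insert_iff.1 hQU).antisymm fun u hu => ?_
      exact Finset.mem_erase.2 ⟨fun h => he (h ▸ hU' hu), hU hu⟩
    rw [this]
    exact hQU'.antisymm (Finset.insert_subset he' hU')

theorem TernaryTree.Rotation.flipStep_or_eq {m : ℕ} (hm : 2 ≤ m) {t t' : TernaryTree}
    (h : Rotation t t') (ht : t.size = m - 1) :
    FlipStep m (t.diagonals m) (t'.diagonals m) ∨ t.diagonals m = t'.diagonals m := by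
  obtain ⟨e, e', U, h1, h2⟩ := h.exists_chords_eq_insert 0
  have sub : ∀ (f : ℕ × ℕ) (s : TernaryTree), s.chords 0 = insert f U →
      (U.erase (0, 2 * m - 1)).image (natChord m) ⊆ s.diagonals m ∧
      s.diagonals m ⊆
        insert (natChord m f) ((U.erase (0, 2 * m - 1)).image (natChord m)) := by
    intro f s hs
    rw [diagonals, hs, ← Finset.image_insert]
    refine ⟨Finset.image_subset_image (Finset.erase_subset_erase _ (Finset.subset_insert _ _)),
      Finset.image_subset_image fun p hp => ?_⟩
    simp only [Finset.mem_erase, Finset.mem_insert] at hp ⊢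
    tauto
  exact IsQuadrangulation.flipStep_or_eq (isQuadrangulation_diagonals hm ht)
    (isQuadrangulation_diagonals hm (h.size_eq.trans ht)) (sub e t h1).1 (sub e' t' h2).1
    (sub e t h1).2 (sub e' t' h2).2

theorem IsQuadrangulation.flips_leftComb {m : ℕ} (hm : 2 ≤ m)
    {Q : Finset (Sym2 (ZMod (2 * m)))} (hQ : IsQuadrangulation m Q) :
    Relation.ReflTransGen (FlipStep m) Q ((TernaryTree.leftComb (m - 1)).diagonals m) := by
  obtain ⟨t, ht, rfl⟩ := hQ.exists_diagonals_eq hm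
  have hr := TernaryTree.rotations_leftComb (m - 1) t ht
  clear hQ
  induction hr using Relation.ReflTransGen.head_induction_on with
  | refl => exact .refl
  | head h _ ih =>
    have ih := ih (h.size_eq.trans ht)
    rcases h.flipStep_or_eq hm ht with hf | hf
    · exact .head hf ih
    · rwa [hf]

/-- The rectangulation lemma: the flip graph whose vertices are the quadrangulations of
the bicolored `2m`-gon and whose edges are edge switches is connected. -/
theorem quadrangulation_flip_connected (m : ℕ) (hm : 2 ≤ m)
    (Q Q' : Finset (Sym2 (ZMod (2 * m))))
    (hQ : IsQuadrangulation m Q) (hQ' : IsQuadrangulation m Q') :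
    Relation.ReflTransGen (FlipStep m) Q Q' := by
  have : Std.Symm (FlipStep m) := ⟨fun _ _ => FlipStep.symm⟩
  exact (hQ.flips_leftComb hm).trans (Std.Symm.symm _ _ (hQ'.flips_leftComb hm))
end

section
/- Let m ≥ 2, let Q be a quadrangulation of the alternately 2-colored convex 2m-gon, and let e be any bicolored diagonal. Let ℓ be the number of diagonals of Q that cross e. Then there is a sequence of ℓ edge switches transforming Q into a quadrangulation Q″ containing e, in which every switch removes a diagonal crossing e and inserts a diagonal not crossing e; consequently every diagonal of Q that does not cross e still belongs to Q″. (This is the inductive engine of the proof of the paper's rectangulation lemma.) -/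
/-- The chord joining the vertices at distances `i` and `j` counterclockwise from `u`. -/
def chordFrom {n : ℕ} (u : ZMod n) (p : ℕ × ℕ) : Sym2 (ZMod n) :=
  s(u + (p.1 : ZMod n), u + (p.2 : ZMod n))

theorem val_add_natCast_sub {n : ℕ} (u : ZMod n) {i j : ℕ} (hi : i < n) (hj : j < n) :
    ((u + (i : ZMod n)) - (u + (j : ZMod n))).val = if j ≤ i then i - j else i + n - j := by
  rw [add_sub_add_left_eq_sub]
  split_ifs with h
  · rw [← Nat.cast_sub h, ZMod.val_natCast, Nat.mod_eq_of_lt (by omega)]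
  · have : (i : ZMod n) - j = ((i + n - j : ℕ) : ZMod n) := by
      rw [Nat.cast_sub (by omega), Nat.cast_add, ZMod.natCast_self, add_zero]
    rw [this, ZMod.val_natCast, Nat.mod_eq_of_lt (by omega)]

theorem cbtw_add_natCast {n : ℕ} (u : ZMod n) {i j k : ℕ} (hi : i < n) (hj : j < n) (hk : k < n) :
    CBtw (u + (i : ZMod n)) (u + (j : ZMod n)) (u + (k : ZMod n)) ↔
      (i < j ∧ j < k) ∨ (j < k ∧ k < i) ∨ (k < i ∧ i < j) := by
  unfold CBtw
  rw [val_add_natCast_sub u hj hi, val_add_natCast_sub u hk hi]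
  split_ifs <;> omega

theorem exists_natCast_add {n : ℕ} [NeZero n] (u a : ZMod n) :
    ∃ i < n, a = u + (i : ZMod n) :=
  ⟨(a - u).val, ZMod.val_lt _, by rw [ZMod.natCast_zmod_val]; ring⟩

theorem add_natCast_inj {n : ℕ} (u : ZMod n) {i j : ℕ} (hi : i < n) (hj : j < n) :
    u + (i : ZMod n) = u + (j : ZMod n) ↔ i = j := by
  rw [add_right_inj, ZMod.natCast_eq_natCast_iff', Nat.mod_eq_of_lt hi, Nat.mod_eq_of_lt hj]

theorem chordFrom_inj {n : ℕ} (u : ZMod n) {p q : ℕ × ℕ} (hp : p.1 < p.2) (hpn : p.2 < n)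
    (hq : q.1 < q.2) (hqn : q.2 < n) : chordFrom u p = chordFrom u q ↔ p = q := by
  unfold chordFrom
  rw [Sym2.eq_iff, add_natCast_inj u (by omega) (by omega), add_natCast_inj u (by omega) (by omega),
    add_natCast_inj u (by omega) (by omega), add_natCast_inj u (by omega) (by omega),
    Prod.ext_iff]
  omega

theorem cross_chordFrom (m : ℕ) (u : ZMod (2 * m)) {p q : ℕ × ℕ} (hp : p.1 < p.2)
    (hpn : p.2 < 2 * m) (hq : q.1 < q.2) (hqn : q.2 < 2 * m) :
    Cross m (chordFrom u p) (chordFrom u q) ↔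
      (p.1 < q.1 ∧ q.1 < p.2 ∧ p.2 < q.2) ∨ (q.1 < p.1 ∧ p.1 < q.2 ∧ q.2 < p.2) := by
  have hp1 : p.1 < 2 * m := by omega
  have hq1 : q.1 < 2 * m := by omega
  constructor
  · rintro ⟨a, b, c, d, h1, h2, h3, h4⟩
    unfold chordFrom at h1 h2
    rw [Sym2.eq_iff] at h1 h2
    rcases h1 with ⟨rfl, rfl⟩ | ⟨rfl, rfl⟩ <;> rcases h2 with ⟨rfl, rfl⟩ | ⟨rfl, rfl⟩ <;>
      rw [cbtw_add_natCast u (by assumption) (by assumption) (by assumption)] at h3 h4 <;> omega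
  · rintro (h | h)
    · refine ⟨_, _, _, _, rfl, rfl, ?_, ?_⟩ <;>
        rw [cbtw_add_natCast u (by assumption) (by assumption) (by assumption)] <;> omega
    · refine ⟨_, _, _, _, rfl, Sym2.eq_swap, ?_, ?_⟩ <;>
        rw [cbtw_add_natCast u (by assumption) (by assumption) (by assumption)] <;> omega

theorem even_val_add_natCast {m : ℕ} [NeZero m] (u : ZMod (2 * m)) (i : ℕ) :
    Even (u + (i : ZMod (2 * m))).val ↔ Even (u.val + i) := by
  rw [ZMod.val_add, ZMod.val_natCast, Nat.add_mod_mod, Nat.even_iff, Nat.even_iff,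
    Nat.mod_mod_of_dvd _ (dvd_mul_right 2 m)]

theorem isBicolDiag_chordFrom {m : ℕ} [NeZero m] (u : ZMod (2 * m)) {p : ℕ × ℕ} (hp : p.1 < p.2)
    (hpn : p.2 < 2 * m) :
    IsBicolDiag m (chordFrom u p) ↔
      (p.1 + p.2) % 2 = 1 ∧ p.1 + 3 ≤ p.2 ∧ p.2 + 3 ≤ 2 * m + p.1 := by
  have hp1 : p.1 < 2 * m := by omega
  have hcol : IsBicolored m (chordFrom u p) ↔ (p.1 + p.2) % 2 = 1 := by
    have key : (Even (u + (p.1 : ZMod (2 * m))).val ↔ ¬ Even (u + (p.2 : ZMod (2 * m))).val) ↔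
        (p.1 + p.2) % 2 = 1 := by
      rw [even_val_add_natCast, even_val_add_natCast, Nat.even_iff, Nat.even_iff]
      omega
    rw [← key]
    constructor
    · rintro ⟨i, j, h, hij⟩
      rcases Sym2.eq_iff.1 h with ⟨h1, h2⟩ | ⟨h1, h2⟩ <;> rw [h1, h2] <;> tauto
    · exact fun h => ⟨_, _, rfl, h⟩
  have hsucc : ∀ {i j : ℕ}, i < 2 * m → j < 2 * m →
      (u + (j : ZMod (2 * m)) = u + (i : ZMod (2 * m)) + 1 ↔
        j = i + 1 ∨ (i + 1 = 2 * m ∧ j = 0)) := by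
    intro i j hi hj
    have : u + (i : ZMod (2 * m)) + 1 = u + ((i + 1 : ℕ) : ZMod (2 * m)) := by push_cast; ring
    rw [this, add_right_inj, ZMod.natCast_eq_natCast_iff', Nat.mod_eq_of_lt hj]
    rcases Nat.lt_or_ge (i + 1) (2 * m) with h | h
    · rw [Nat.mod_eq_of_lt h]; omega
    · rw [show i + 1 = 2 * m by omega, Nat.mod_self]; omega
  have hdiag : IsDiag m (chordFrom u p) ↔ p.1 + 2 ≤ p.2 ∧ p.2 + 2 ≤ 2 * m + p.1 := by
    have key : (u + (p.1 : ZMod (2 * m)) ≠ u + (p.2 : ZMod (2 * m)) ∧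
        u + (p.2 : ZMod (2 * m)) ≠ u + (p.1 : ZMod (2 * m)) + 1 ∧
        u + (p.1 : ZMod (2 * m)) ≠ u + (p.2 : ZMod (2 * m)) + 1) ↔
        p.1 + 2 ≤ p.2 ∧ p.2 + 2 ≤ 2 * m + p.1 := by
      rw [Ne, Ne, Ne, hsucc hp1 hpn, hsucc hpn hp1, add_natCast_inj u hp1 hpn]
      omega
    rw [← key]
    constructor
    · rintro ⟨i, j, h, hij⟩
      rcases Sym2.eq_iff.1 h with ⟨h1, h2⟩ | ⟨h1, h2⟩ <;> rw [h1, h2]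
      · exact hij
      · exact ⟨hij.1.symm, hij.2.2, hij.2.1⟩
    · exact fun h => ⟨_, _, rfl, h⟩
  rw [IsBicolDiag, hcol, hdiag]
  omega

theorem exists_eq_chordFrom {n : ℕ} [NeZero n] (u : ZMod n) {e : Sym2 (ZMod n)}
    (he : ¬ e.IsDiag) : ∃ p : ℕ × ℕ, p.1 < p.2 ∧ p.2 < n ∧ e = chordFrom u p := by
  induction e with
  | _ a b =>
    obtain ⟨i, hi, rfl⟩ := exists_natCast_add u a
    obtain ⟨j, hj, rfl⟩ := exists_natCast_add u b
    rcases lt_trichotomy i j with h | rfl | h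
    · exact ⟨(i, j), h, hj, rfl⟩
    · simp at he
    · exact ⟨(j, i), h, hi, Sym2.eq_swap⟩

theorem IsBicolDiag.not_isDiag {m : ℕ} {e : Sym2 (ZMod (2 * m))} (he : IsBicolDiag m e) :
    ¬ e.IsDiag := by
  obtain ⟨⟨i, j, rfl, hij, -⟩, -⟩ := he
  simpa using hij

theorem IsBicolDiag.exists_eq_chordFrom {m : ℕ} [NeZero m] (u : ZMod (2 * m))
    {e : Sym2 (ZMod (2 * m))} (he : IsBicolDiag m e) :
    ∃ p : ℕ × ℕ, p.1 < p.2 ∧ p.2 < 2 * m ∧ e = chordFrom u p ∧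
      (p.1 + p.2) % 2 = 1 ∧ p.1 + 3 ≤ p.2 ∧ p.2 + 3 ≤ 2 * m + p.1 := by
  obtain ⟨p, h1, h2, rfl⟩ := _root_.exists_eq_chordFrom u he.not_isDiag
  exact ⟨p, h1, h2, rfl, (isBicolDiag_chordFrom u h1 h2).1 he⟩

/-- A finite family of non-crossing intervals of odd length at least three. -/
structure IsOddLaminar (F : Finset (ℕ × ℕ)) : Prop where
  odd : ∀ p ∈ F, (p.1 + p.2) % 2 = 1
  length : ∀ p ∈ F, p.1 + 3 ≤ p.2
  noncrossing : ∀ p ∈ F, ∀ q ∈ F, ¬ (p.1 < q.1 ∧ q.1 < p.2 ∧ p.2 < q.2)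

/-- Every interval of the family contains an odd interior point that no smaller interval of the
family contains in its interior. -/
theorem IsOddLaminar.exists_odd_uncovered {F : Finset (ℕ × ℕ)} (hF : IsOddLaminar F)
    {p : ℕ × ℕ} (hp : p ∈ F) :
    ∃ z, z % 2 = 1 ∧ p.1 < z ∧ z < p.2 ∧
      ∀ q ∈ F, q.1 < z → z < q.2 → p.1 ≤ q.1 → q.2 ≤ p.2 → q = p := by
  have hodd := hF.odd p hp
  have hlen := hF.length p hp
  rcases Nat.mod_two_eq_zero_or_one p.1 with hpar | hpar
  · let S := insert (p.1 + 1) ((F.filter fun q => q.1 = p.1 ∧ q.2 < p.2).image Prod.snd)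
    obtain ⟨z, hz, hmax⟩ := S.exists_max_image id ⟨_, Finset.mem_insert_self _ _⟩
    simp only [S, Finset.mem_insert, Finset.mem_image, Finset.mem_filter, id,
      forall_eq_or_imp] at hz hmax
    have hz' : z % 2 = 1 ∧ p.1 < z ∧ z < p.2 := by
      rcases hz with rfl | ⟨q, ⟨hq, h1, h2⟩, rfl⟩
      · omega
      · have := hF.odd q hq
        have := hF.length q hq
        omega
    refine ⟨z, hz'.1, hz'.2.1, hz'.2.2, fun q hq h1 h2 h3 h4 => ?_⟩
    by_contra hne
    rw [Prod.ext_iff] at hne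
    by_cases hq1 : q.1 = p.1
    · have := hmax.2 q.2 ⟨q, ⟨hq, hq1, by omega⟩, rfl⟩
      omega
    · rcases hz with rfl | ⟨r, ⟨hr, h5, h6⟩, rfl⟩
      · omega
      · exact hF.noncrossing r hr q hq (by omega)
  · let S := insert (p.2 - 1) ((F.filter fun q => q.2 = p.2 ∧ p.1 < q.1).image Prod.fst)
    obtain ⟨z, hz, hmin⟩ := S.exists_min_image id ⟨_, Finset.mem_insert_self _ _⟩
    simp only [S, Finset.mem_insert, Finset.mem_image, Finset.mem_filter, id,
      forall_eq_or_imp] at hz hmin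
    have hz' : z % 2 = 1 ∧ p.1 < z ∧ z < p.2 := by
      rcases hz with rfl | ⟨q, ⟨hq, h1, h2⟩, rfl⟩
      · omega
      · have := hF.odd q hq
        have := hF.length q hq
        omega
    refine ⟨z, hz'.1, hz'.2.1, hz'.2.2, fun q hq h1 h2 h3 h4 => ?_⟩
    by_contra hne
    rw [Prod.ext_iff] at hne
    by_cases hq2 : q.2 = p.2
    · have := hmin.2 q.1 ⟨q, ⟨hq, hq2, by omega⟩, rfl⟩
      omega
    · rcases hz with rfl | ⟨r, ⟨hr, h5, h6⟩, rfl⟩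
      · omega
      · exact hF.noncrossing q hq r hr (by omega)

theorem IsOddLaminar.card_le {F : Finset (ℕ × ℕ)} (hF : IsOddLaminar F) {m : ℕ}
    (hm : ∀ p ∈ F, p.2 < 2 * m) : F.card ≤ m - 1 := by
  choose! z hodd hlt hgt huniq using fun p hp => hF.exists_odd_uncovered (p := p) hp
  have := Finset.card_le_card_of_injOn (s := F) (t := Finset.range (m - 1)) (fun p => z p / 2)
    (fun p hp => by
      have hp : p ∈ F := hp
      have := hm p hp
      have := hgt p hp
      have := hodd p hp
      simp only [Finset.coe_range, Set.mem_Iio]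
      omega)
    (fun p hp q hq hpq => by
      have hp : p ∈ F := hp
      have hq : q ∈ F := hq
      have h1 := hodd p hp
      have h2 := hodd q hq
      have h3 := hlt p hp
      have h4 := hlt q hq
      have h5 := hgt p hp
      have h6 := hgt q hq
      have hz : z p = z q := by
        simp only at hpq
        omega
      have h7 := hF.noncrossing p hp q hq
      have h8 := hF.noncrossing q hq p hp
      by_cases hsub : p.1 ≤ q.1 ∧ q.2 ≤ p.2
      · exact (huniq p hp q hq (by omega) (by omega) hsub.1 hsub.2).symm
      · exact huniq q hq p hp (by omega) (by omega) (by omega) (by omega))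
  simpa using this

open Classical in
/-- The chords in `Q`, as pairs of distances from `u`. -/
noncomputable def chordPairs {n : ℕ} (u : ZMod n) (Q : Finset (Sym2 (ZMod n))) :
    Finset (ℕ × ℕ) :=
  (Finset.range n ×ˢ Finset.range n).filter fun p => p.1 < p.2 ∧ chordFrom u p ∈ Q

theorem mem_chordPairs {n : ℕ} {u : ZMod n} {Q : Finset (Sym2 (ZMod n))} {p : ℕ × ℕ} :
    p ∈ chordPairs u Q ↔ p.1 < p.2 ∧ p.2 < n ∧ chordFrom u p ∈ Q := by
  simp only [chordPairs, Finset.mem_filter, Finset.mem_product, Finset.mem_range]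
  constructor
  · tauto
  · exact fun h => ⟨⟨h.1.trans h.2.1, h.2.1⟩, h.1, h.2.2⟩

theorem isOddLaminar_chordPairs {m : ℕ} [NeZero m] (u : ZMod (2 * m))
    {Q : Finset (Sym2 (ZMod (2 * m)))} (hQ : ∀ e ∈ Q, IsBicolDiag m e)
    (hcross : ∀ e ∈ Q, ∀ f ∈ Q, ¬ Cross m e f) : IsOddLaminar (chordPairs u Q) where
  odd p hp := by
    obtain ⟨h1, h2, h3⟩ := mem_chordPairs.1 hp
    exact ((isBicolDiag_chordFrom u h1 h2).1 (hQ _ h3)).1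
  length p hp := by
    obtain ⟨h1, h2, h3⟩ := mem_chordPairs.1 hp
    exact ((isBicolDiag_chordFrom u h1 h2).1 (hQ _ h3)).2.1
  noncrossing p hp q hq h := by
    obtain ⟨h1, h2, h3⟩ := mem_chordPairs.1 hp
    obtain ⟨h4, h5, h6⟩ := mem_chordPairs.1 hq
    exact hcross _ h3 _ h6 ((cross_chordFrom m u h1 h2 h4 h5).2 (Or.inl h))

/-- A family of pairwise non-crossing bicolored diagonals has at most `m - 2` members. -/
theorem card_le_of_noncrossing {m : ℕ} (hm : 2 ≤ m) {Q : Finset (Sym2 (ZMod (2 * m)))}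
    (hQ : ∀ e ∈ Q, IsBicolDiag m e) (hcross : ∀ e ∈ Q, ∀ f ∈ Q, ¬ Cross m e f) :
    Q.card ≤ m - 2 := by
  classical
  have : NeZero m := ⟨by omega⟩
  have hF := isOddLaminar_chordPairs 0 hQ hcross
  have hcard : Q.card ≤ (chordPairs 0 Q).card := by
    refine Finset.card_le_card_of_surjOn (chordFrom 0) fun e he => ?_
    obtain ⟨p, h1, h2, rfl, -⟩ := (hQ e he).exists_eq_chordFrom 0
    exact ⟨p, mem_chordPairs.2 ⟨h1, h2, he⟩, rfl⟩
  have hroot : (0, 2 * m - 1) ∉ chordPairs 0 Q := fun h => by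
    obtain ⟨h1, h2, h3⟩ := mem_chordPairs.1 h
    have := ((isBicolDiag_chordFrom 0 h1 h2).1 (hQ _ h3)).2.2
    simp only at this
    omega
  have hlam : IsOddLaminar (insert (0, 2 * m - 1) (chordPairs 0 Q)) := by
    constructor
    · simp only [Finset.mem_insert, forall_eq_or_imp]
      exact ⟨by omega, hF.odd⟩
    · simp only [Finset.mem_insert, forall_eq_or_imp]
      exact ⟨by omega, hF.length⟩
    · simp only [Finset.mem_insert, forall_eq_or_imp]
      refine ⟨⟨by omega, fun q hq => ?_⟩, fun p hp => ⟨by omega, hF.noncrossing p hp⟩⟩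
      have := (mem_chordPairs.1 hq).2.1
      omega
  have := hlam.card_le (m := m) (by
    simp only [Finset.mem_insert, forall_eq_or_imp]
    exact ⟨by omega, fun p hp => (mem_chordPairs.1 hp).2.1⟩)
  rw [Finset.card_insert_of_notMem hroot] at this
  omega

theorem cross_comm {m : ℕ} {e f : Sym2 (ZMod (2 * m))} [NeZero m] (he : ¬ e.IsDiag)
    (hf : ¬ f.IsDiag) : Cross m e f ↔ Cross m f e := by
  obtain ⟨p, h1, h2, rfl⟩ := exists_eq_chordFrom 0 he
  obtain ⟨q, h3, h4, rfl⟩ := exists_eq_chordFrom 0 hf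
  rw [cross_chordFrom m 0 h1 h2 h3 h4, cross_chordFrom m 0 h3 h4 h1 h2, or_comm]

theorem not_cross_self {m : ℕ} [NeZero m] {e : Sym2 (ZMod (2 * m))} (he : ¬ e.IsDiag) :
    ¬ Cross m e e := by
  obtain ⟨p, h1, h2, rfl⟩ := exists_eq_chordFrom 0 he
  rw [cross_chordFrom m 0 h1 h2 h1 h2]
  omega

theorem IsQuadrangulation.mem_of_forall_not_cross {m : ℕ} (hm : 2 ≤ m)
    {Q : Finset (Sym2 (ZMod (2 * m)))} (hQ : IsQuadrangulation m Q)
    {e : Sym2 (ZMod (2 * m))} (he : IsBicolDiag m e) (h : ∀ g ∈ Q, ¬ Cross m g e) : e ∈ Q := by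
  classical
  have : NeZero m := ⟨by omega⟩
  by_contra hne
  have hle := card_le_of_noncrossing hm (Q := insert e Q)
    (by simpa only [Finset.mem_insert, forall_eq_or_imp] using ⟨he, hQ.1⟩)
    (by
      simp only [Finset.mem_insert, forall_eq_or_imp]
      exact ⟨⟨not_cross_self he.not_isDiag, fun g hg hc =>
        h g hg ((cross_comm he.not_isDiag (hQ.1 g hg).not_isDiag).1 hc)⟩,
        fun g hg => ⟨h g hg, hQ.2.1 g hg⟩⟩)
  rw [Finset.card_insert_of_notMem hne, hQ.2.2] at hle
  omega

open Classical in
/-- If some diagonal of `Q` crosses `e`, then a diagonal crossing `e` can be switched to one that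
does not cross `e`. -/
theorem IsQuadrangulation.exists_switch {m : ℕ} (hm : 2 ≤ m)
    {Q : Finset (Sym2 (ZMod (2 * m)))} (hQ : IsQuadrangulation m Q)
    {e : Sym2 (ZMod (2 * m))} (he : IsBicolDiag m e) (h : ∃ g ∈ Q, Cross m g e) :
    ∃ g g', g ∈ Q ∧ Cross m g e ∧ g' ∉ Q ∧ ¬ Cross m g' e ∧
      IsQuadrangulation m (insert g' (Q.erase g)) := by
  have : NeZero m := ⟨by omega⟩
  obtain ⟨u, v, hv0, hvm, rfl⟩ : ∃ (u : ZMod (2 * m)) (v : ℕ), 0 < v ∧ v < 2 * m ∧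
      e = chordFrom u (0, v) := by
    obtain ⟨⟨a, b, rfl, hab, -⟩, -⟩ := he
    obtain ⟨v, hv, rfl⟩ := exists_natCast_add a b
    refine ⟨a, v, Nat.pos_of_ne_zero ?_, hv, by simp [chordFrom]⟩
    rintro rfl
    simp at hab
  have hF := isOddLaminar_chordPairs u hQ.1 hQ.2.1
  have hcr : ∀ p ∈ chordPairs u Q, (Cross m (chordFrom u p) (chordFrom u (0, v)) ↔
      0 < p.1 ∧ p.1 < v ∧ v < p.2) := by
    intro p hp
    obtain ⟨h1, h2, -⟩ := mem_chordPairs.1 hp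
    rw [cross_chordFrom m u h1 h2 hv0 hvm]
    simp only
    omega
  obtain ⟨p, hp, hmax⟩ := ((chordPairs u Q).filter fun p =>
      0 < p.1 ∧ p.1 < v ∧ v < p.2).exists_max_image (fun p => p.2 - p.1) (by
    obtain ⟨g, hg, hc⟩ := h
    obtain ⟨p, h1, h2, rfl, -⟩ := (hQ.1 g hg).exists_eq_chordFrom u
    have hp := mem_chordPairs.2 ⟨h1, h2, hg⟩
    exact ⟨p, Finset.mem_filter.2 ⟨hp, (hcr p hp).1 hc⟩⟩)
  rw [Finset.mem_filter] at hp
  obtain ⟨hp, hp0, hpv, hvp⟩ := hp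
  obtain ⟨hp12, hpm, hpQ⟩ := mem_chordPairs.1 hp
  obtain ⟨z, hodd, hpz, hzp, hz⟩ := hF.exists_odd_uncovered hp
  have hz0 : 0 < z := by omega
  have hzm : z < 2 * m := by omega
  have honly : ∀ q ∈ chordPairs u Q, 0 < q.1 → q.1 < z → z < q.2 → q = p := by
    intro q hq h0 h1 h2
    have hpq := hF.noncrossing p hp q hq
    have hqp := hF.noncrossing q hq p hp
    by_cases hsub : p.1 ≤ q.1 ∧ q.2 ≤ p.2
    · exact hz q hq h1 h2 hsub.1 hsub.2
    · have := hmax q (Finset.mem_filter.2 ⟨hq, by omega⟩)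
      omega
  have hcross_z : ∀ q ∈ chordPairs u Q, (Cross m (chordFrom u q) (chordFrom u (0, z)) ↔
      0 < q.1 ∧ q.1 < z ∧ z < q.2) := by
    intro q hq
    obtain ⟨h1, h2, -⟩ := mem_chordPairs.1 hq
    rw [cross_chordFrom m u h1 h2 hz0 hzm]
    simp only
    omega
  have hz_diag : IsBicolDiag m (chordFrom u (0, z)) := by
    rw [isBicolDiag_chordFrom u hz0 hzm]
    simp only
    omega
  have hz_notMem : chordFrom u (0, z) ∉ Q := fun hmem =>
    hQ.2.1 _ hpQ _ hmem ((hcross_z p hp).2 ⟨hp0, hpz, hzp⟩)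
  have hz_cross : ∀ g ∈ Q.erase (chordFrom u p), ¬ Cross m g (chordFrom u (0, z)) := by
    intro g hg hc
    obtain ⟨hne, hg⟩ := Finset.mem_erase.1 hg
    obtain ⟨q, h1, h2, rfl, -⟩ := (hQ.1 g hg).exists_eq_chordFrom u
    have hq := mem_chordPairs.2 ⟨h1, h2, hg⟩
    obtain ⟨h3, h4, h5⟩ := (hcross_z q hq).1 hc
    exact hne (by rw [honly q hq h3 h4 h5])
  refine ⟨chordFrom u p, chordFrom u (0, z), hpQ, (hcr p hp).2 ⟨hp0, hpv, hvp⟩, hz_notMem, ?_,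
    ?_, ?_, ?_⟩
  · rw [cross_chordFrom m u hz0 hzm hv0 hvm]
    simp only
    omega
  · simp only [Finset.mem_insert, forall_eq_or_imp]
    exact ⟨hz_diag, fun g hg => hQ.1 g (Finset.mem_of_mem_erase hg)⟩
  · simp only [Finset.mem_insert, forall_eq_or_imp]
    exact ⟨⟨not_cross_self hz_diag.not_isDiag, fun g hg hc => hz_cross g hg
      ((cross_comm hz_diag.not_isDiag (hQ.1 g (Finset.mem_of_mem_erase hg)).not_isDiag).1 hc)⟩,
      fun g hg => ⟨hz_cross g hg, fun f hf =>
        hQ.2.1 g (Finset.mem_of_mem_erase hg) f (Finset.mem_of_mem_erase hf)⟩⟩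
  · rw [Finset.card_insert_of_notMem (fun hmem => hz_notMem (Finset.mem_of_mem_erase hmem)),
      Finset.card_erase_add_one hpQ, hQ.2.2]

open Classical in
theorem quadrangulation_accommodates_diagonal (m : ℕ) (hm : 2 ≤ m)
    (Q : Finset (Sym2 (ZMod (2 * m)))) (hQ : IsQuadrangulation m Q)
    (e : Sym2 (ZMod (2 * m))) (he : IsBicolDiag m e) (ℓ : ℕ)
    (hℓ : ℓ = (Q.filter fun g => Cross m g e).card) :
    ∃ Qs : ℕ → Finset (Sym2 (ZMod (2 * m))),
      Qs 0 = Q ∧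
      (∀ i ≤ ℓ, IsQuadrangulation m (Qs i)) ∧
      (∀ i < ℓ, ∃ g g', g ∈ Qs i ∧ Cross m g e ∧ g' ∉ Qs i ∧ ¬ Cross m g' e ∧
        Qs (i + 1) = insert g' ((Qs i).erase g)) ∧
      e ∈ Qs ℓ ∧
      (∀ f ∈ Q, ¬ Cross m f e → f ∈ Qs ℓ) := by
  induction ℓ generalizing Q with
  | zero =>
    have hnone : ∀ g ∈ Q, ¬ Cross m g e := by
      simpa [Finset.filter_eq_empty_iff] using hℓ.symm
    exact ⟨fun _ => Q, rfl, fun _ _ => hQ, fun i hi => absurd hi (Nat.not_lt_zero i),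
      hQ.mem_of_forall_not_cross hm he hnone, fun f hf _ => hf⟩
  | succ k ih =>
    have hex : ∃ g ∈ Q, Cross m g e := by
      obtain ⟨g, hg⟩ := Finset.card_pos.1 (k.succ_pos.trans_eq hℓ)
      exact ⟨g, (Finset.mem_filter.1 hg).1, (Finset.mem_filter.1 hg).2⟩
    obtain ⟨g, g', hgQ, hge, hg'Q, hg'e, hQ'⟩ := hQ.exists_switch hm he hex
    obtain ⟨Qs, h0, h1, h2, h3, h4⟩ := ih (insert g' (Q.erase g)) hQ' (by
      rw [Finset.filter_insert, if_neg hg'e, Finset.filter_erase,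
        Finset.card_erase_of_mem (Finset.mem_filter.2 ⟨hgQ, hge⟩), ← hℓ, Nat.add_sub_cancel])
    refine ⟨fun i => Nat.casesOn i Q Qs, rfl, ?_, ?_, h3, ?_⟩
    · rintro (_ | i) hi
      · exact hQ
      · exact h1 i (by omega)
    · rintro (_ | i) hi
      · exact ⟨g, g', hgQ, hge, hg'Q, hg'e, h0⟩
      · exact h2 i (by omega)
    · intro f hf hfe
      refine h4 f (Finset.mem_insert_of_mem (Finset.mem_erase.2 ⟨?_, hf⟩)) hfe
      rintro rfl
      exact hfe hge
end

section
/- With C, C*, d, d* and ∂ = d⊗id + id⊗d* as in the context: (i) d∘d = 0, d*∘d* = 0 and ∂∘∂ = 0; (ii) the element x₀ ⊗ y₁* of C ⊗_R C* is a cycle, ∂(x₀⊗y₁*) = 0, and it is not a boundary, x₀⊗y₁* ∉ range(∂); (iii) the image of x₀⊗y₁* remains a cycle that is not a boundary after base change of the complex along each of the quotient maps R → R/(u), R → R/(v), and R → R/(u,v) = 𝔽; (iv) the element 𝔱 := x⊗x* + x₀⊗x₀* + x₁⊗x₁* + y₀⊗y₀* + y₁⊗y₁* satisfies ∂(𝔱)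 = 0, so 𝔱 and 𝔱′ := 𝔱 + x₀⊗y₁* are cycles lying in distinct homology classes of (C⊗_R C*, ∂). -/
/-!
Statement 8: the figure-eight knot complex and its dual.  `𝔽 = ℤ/2`, `R = 𝔽[u,v]`
(realized as `MvPolynomial (Fin 2) (ZMod 2)` with `u = X 0`, `v = X 1`).
`C` is free on `x, x₀, x₁, y₀, y₁` (basis indices `0,1,2,3,4` of `Fin 5`) with
differential `d`, and `C*` is free on `x*, x₀*, x₁*, y₀*, y₁*` (same indexing) with
differential `d*`; `∂ = d ⊗ id + id ⊗ d*` on `C ⊗[R] C*`.  Claims: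
(i) `d∘d = 0`, `d*∘d* = 0`, `∂∘∂ = 0`;
(ii) `x₀ ⊗ y₁*` is a cycle and not a boundary;
(iii) this persists after base change along `R → R/(u)`, `R → R/(v)`, `R → R/(u,v)`;
(iv) `𝔱 = x⊗x* + x₀⊗x₀* + x₁⊗x₁* + y₀⊗y₀* + y₁⊗y₁*` is a cycle, so `𝔱` and
`𝔱' = 𝔱 + x₀⊗y₁*` are cycles in distinct homology classes.
-/

open MvPolynomial TensorProduct

set_option maxHeartbeats 1000000
set_option synthInstance.maxHeartbeats 400000

/-- The ground ring `R = 𝔽₂[u,v]`. -/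
abbrev Rfe : Type := MvPolynomial (Fin 2) (ZMod 2)

/-- The underlying free `R`-module of rank 5 for the figure-eight complex. -/
abbrev Cfe : Type := Fin 5 →₀ Rfe

noncomputable instance : Zero (Cfe ⊗[Rfe] Cfe) := AddMonoid.toZero

noncomputable instance : Sub (Cfe ⊗[Rfe] Cfe) := SubNegMonoid.toSub

noncomputable instance (A : Type) [CommRing A] [Algebra Rfe A] :
    Zero (A ⊗[Rfe] (Cfe ⊗[Rfe] Cfe)) := AddMonoid.toZero

/-- `t` is a cycle and not a boundary for the complex obtained from
`(Cfe ⊗ Cfe, bd)` by base change along `Rfe → A`. -/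
def CycleNotBoundary (A : Type) [CommRing A] [Algebra Rfe A]
    (bd : (Cfe ⊗[Rfe] Cfe) →ₗ[Rfe] (Cfe ⊗[Rfe] Cfe)) (t : Cfe ⊗[Rfe] Cfe) : Prop :=
  LinearMap.baseChange A bd ((1 : A) ⊗ₜ[Rfe] t) = 0 ∧
    (1 : A) ⊗ₜ[Rfe] t ∉ LinearMap.range (LinearMap.baseChange A bd)

theorem add_self_eq_zero_of_module_Rfe {M : Type*} [AddCommMonoid M] [Module Rfe M] (m : M) :
    m + m = 0 := by
  have h : (2 : Rfe) = 0 := CharTwo.two_eq_zero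
  rw [← two_smul Rfe m, h, zero_smul]

theorem add_cycle_eq_zero_of_module_Rfe {M : Type*} [AddCommMonoid M] [Module Rfe M]
    (a b c e : M) : a + b + (b + c) + (a + e) + (e + c) = 0 := by
  have h : a + b + (b + c) + (a + e) + (e + c) = (a + b + c + e) + (a + b + c + e) := by abel
  rw [h, add_self_eq_zero_of_module_Rfe]

theorem single_eq_smul_single_one (i : Fin 5) (r : Rfe) :
    (Finsupp.single i r : Cfe) = r • Finsupp.single i 1 := by
  simp

/-- An endomorphism of `Cfe` whose matrix entries lie in `(u, v)` takes values in `(u, v) Cfe`. -/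
theorem constantCoeff_apply_eq_zero (f : Cfe →ₗ[Rfe] Cfe)
    (hf : ∀ j i, constantCoeff (f (Finsupp.single j 1) i) = 0) (c : Cfe) (i : Fin 5) :
    constantCoeff (f c i) = 0 := by
  induction c using Finsupp.induction_linear with
  | zero => simp
  | add a b ha hb => simp [ha, hb]
  | single j r =>
    rw [single_eq_smul_single_one, map_smul, Finsupp.smul_apply, smul_eq_mul, map_mul, hf, mul_zero]

/-- The coefficient of the `(i, j)` basis element in `Cfe ⊗ Cfe`. -/
noncomputable def tensorCoeff (i j : Fin 5) : (Cfe ⊗[Rfe] Cfe) →ₗ[Rfe] Rfe :=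
  LinearMap.mul' Rfe Rfe ∘ₗ TensorProduct.map (Finsupp.lapply i) (Finsupp.lapply j)

@[simp]
theorem tensorCoeff_tmul (i j : Fin 5) (a b : Cfe) :
    tensorCoeff i j (a ⊗ₜ[Rfe] b) = a i * b j := by
  simp [tensorCoeff]

theorem constantCoeff_tensorCoeff_eq_zero (f g : Cfe →ₗ[Rfe] Cfe)
    (hf : ∀ j i, constantCoeff (f (Finsupp.single j 1) i) = 0)
    (hg : ∀ j i, constantCoeff (g (Finsupp.single j 1) i) = 0) (i j : Fin 5)
    (z : Cfe ⊗[Rfe] Cfe) :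
    constantCoeff (tensorCoeff i j
      ((TensorProduct.map f LinearMap.id + TensorProduct.map LinearMap.id g :
        (Cfe ⊗[Rfe] Cfe) →ₗ[Rfe] (Cfe ⊗[Rfe] Cfe)) z)) = 0 := by
  induction z using TensorProduct.induction_on with
  | zero => simp only [map_zero]
  | add a b ha hb => rw [map_add, map_add, map_add, ha, hb, add_zero]
  | tmul a b =>
    rw [LinearMap.add_apply, map_add, TensorProduct.map_tmul, TensorProduct.map_tmul,
      tensorCoeff_tmul, tensorCoeff_tmul, map_add, map_mul, map_mul, LinearMap.id_apply,
      LinearMap.id_apply, constantCoeff_apply_eq_zero f hf, constantCoeff_apply_eq_zero g hg,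
      zero_mul, mul_zero, add_zero]

/-- A cycle with a coefficient outside `(u, v)` is not a boundary after base change to a quotient
by an ideal contained in `(u, v)`, if the differential takes values in multiples of `(u, v)`. -/
theorem cycleNotBoundary_quotient (I : Ideal Rfe) (hI : ∀ r ∈ I, constantCoeff r = 0)
    (bd : (Cfe ⊗[Rfe] Cfe) →ₗ[Rfe] (Cfe ⊗[Rfe] Cfe)) (φ : (Cfe ⊗[Rfe] Cfe) →ₗ[Rfe] Rfe)
    (hφ : ∀ z, constantCoeff (φ (bd z)) = 0) (t : Cfe ⊗[Rfe] Cfe) (ht : bd t = 0)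
    (hφt : constantCoeff (φ t) ≠ 0) : CycleNotBoundary (Rfe ⧸ I) bd t := by
  let ε : (Rfe ⧸ I) →+* ZMod 2 := Ideal.Quotient.lift I constantCoeff hI
  let Φ : ((Rfe ⧸ I) ⊗[Rfe] (Cfe ⊗[Rfe] Cfe)) →ₗ[Rfe] (Rfe ⧸ I) :=
    TensorProduct.lift ((LinearMap.lsmul Rfe (Rfe ⧸ I)).comp φ).flip
  have hΦ (a : Rfe ⧸ I) (z : Cfe ⊗[Rfe] Cfe) :
      ε (Φ (a ⊗ₜ z)) = constantCoeff (φ z) * ε a := by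
    change ε (Ideal.Quotient.mk I (φ z) * a) = _
    rw [map_mul]
    rfl
  refine ⟨?_, ?_⟩
  · rw [LinearMap.baseChange_tmul, ht]
    exact TensorProduct.tmul_zero _ _
  · rintro ⟨w, hw⟩
    have hzero : ε (Φ (LinearMap.baseChange (Rfe ⧸ I) bd w)) = 0 := by
      clear hw
      induction w using TensorProduct.induction_on with
      | zero => simp only [map_zero]
      | add a b ha hb => rw [map_add, map_add, map_add, ha, hb, add_zero]
      | tmul a z => rw [LinearMap.baseChange_tmul, hΦ, hφ, zero_mul]
    rw [hw, hΦ, map_one, mul_one] at hzero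
    exact hφt hzero

theorem constantCoeff_eq_zero_of_mem_span {s : Set Rfe} (hs : ∀ r ∈ s, constantCoeff r = 0)
    (r : Rfe) (hr : r ∈ Ideal.span s) : constantCoeff r = 0 :=
  (Ideal.span_le (I := RingHom.ker (constantCoeff (R := ZMod 2) (σ := Fin 2)))).2 hs hr

theorem tensor_differential_comp_self (f g : Cfe →ₗ[Rfe] Cfe) (hf : f.comp f = 0)
    (hg : g.comp g = 0) :
    (TensorProduct.map f LinearMap.id + TensorProduct.map LinearMap.id g).comp
      (TensorProduct.map f LinearMap.id + TensorProduct.map LinearMap.id g) = 0 := by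
  rw [LinearMap.add_comp, LinearMap.comp_add, LinearMap.comp_add, ← TensorProduct.map_comp,
    ← TensorProduct.map_comp, ← TensorProduct.map_comp, ← TensorProduct.map_comp, hf, hg]
  simp only [LinearMap.id_comp, LinearMap.comp_id, TensorProduct.map_zero_left,
    TensorProduct.map_zero_right, zero_add, add_zero]
  exact add_self_eq_zero_of_module_Rfe (TensorProduct.map f g)

theorem figure_eight_slice_disk_invariants
    (d d' : Cfe →ₗ[Rfe] Cfe)
    -- `d` : d(x) = 0, d(x₀) = 0, d(x₁) = v·x₀, d(y₀) = u·x₀, d(y₁) = v·y₀ + u·x₁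
    (hdx : d (Finsupp.single 0 1) = 0)
    (hdx0 : d (Finsupp.single 1 1) = 0)
    (hdx1 : d (Finsupp.single 2 1) = Finsupp.single 1 (X 1))
    (hdy0 : d (Finsupp.single 3 1) = Finsupp.single 1 (X 0))
    (hdy1 : d (Finsupp.single 4 1) = Finsupp.single 3 (X 1) + Finsupp.single 2 (X 0))
    -- `d*` : d*(x*) = 0, d*(y₁*) = 0, d*(x₁*) = u·y₁*, d*(y₀*) = v·y₁*,
    --        d*(x₀*) = u·y₀* + v·x₁*
    (hd'x : d' (Finsupp.single 0 1) = 0)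
    (hd'y1 : d' (Finsupp.single 4 1) = 0)
    (hd'x1 : d' (Finsupp.single 2 1) = Finsupp.single 4 (X 0))
    (hd'y0 : d' (Finsupp.single 3 1) = Finsupp.single 4 (X 1))
    (hd'x0 : d' (Finsupp.single 1 1) = Finsupp.single 3 (X 0) + Finsupp.single 2 (X 1)) :
    d.comp d = 0 ∧ d'.comp d' = 0 ∧
    (let bd : (Cfe ⊗[Rfe] Cfe) →ₗ[Rfe] (Cfe ⊗[Rfe] Cfe) :=
        TensorProduct.map d LinearMap.id + TensorProduct.map LinearMap.id d'
     let t₀ : Cfe ⊗[Rfe] Cfe := Finsupp.single 1 1 ⊗ₜ[Rfe] Finsupp.single 4 1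
     let t : Cfe ⊗[Rfe] Cfe :=
        Finsupp.single 0 1 ⊗ₜ[Rfe] Finsupp.single 0 1 +
        Finsupp.single 1 1 ⊗ₜ[Rfe] Finsupp.single 1 1 +
        Finsupp.single 2 1 ⊗ₜ[Rfe] Finsupp.single 2 1 +
        Finsupp.single 3 1 ⊗ₜ[Rfe] Finsupp.single 3 1 +
        Finsupp.single 4 1 ⊗ₜ[Rfe] Finsupp.single 4 1
     bd.comp bd = 0 ∧
     bd t₀ = 0 ∧ t₀ ∉ LinearMap.range bd ∧
     CycleNotBoundary (Rfe ⧸ Ideal.span {(X 0 : Rfe)}) bd t₀ ∧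
     CycleNotBoundary (Rfe ⧸ Ideal.span {(X 1 : Rfe)}) bd t₀ ∧
     CycleNotBoundary (Rfe ⧸ Ideal.span {(X 0 : Rfe), (X 1 : Rfe)}) bd t₀ ∧
     bd t = 0 ∧ bd (t + t₀) = 0 ∧ (t + t₀) - t ∉ LinearMap.range bd) := by
  rw [single_eq_smul_single_one _ (X _)] at hdx1 hdy0 hd'x1 hd'y0
  rw [single_eq_smul_single_one _ (X _), single_eq_smul_single_one _ (X _)] at hdy1 hd'x0
  have hd (j i : Fin 5) : constantCoeff (d (Finsupp.single j 1) i) = 0 := by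
    fin_cases j <;> simp [hdx, hdx0, hdx1, hdy0, hdy1, -Finsupp.smul_single]
  have hd' (j i : Fin 5) : constantCoeff (d' (Finsupp.single j 1) i) = 0 := by
    fin_cases j <;> simp [hd'x, hd'x0, hd'x1, hd'y0, hd'y1, -Finsupp.smul_single]
  have hdd : d.comp d = 0 := by
    refine Finsupp.lhom_ext' fun j => LinearMap.ext_ring ?_
    fin_cases j <;> simp only [LinearMap.comp_apply, Finsupp.lsingle_apply, Fin.reduceFinMk,
      Fin.zero_eta, Fin.mk_one, hdx, hdx0, hdx1, hdy0, hdy1, map_zero, map_add, map_smul,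
      smul_zero, LinearMap.zero_apply]
    rw [smul_comm]
    exact add_self_eq_zero_of_module_Rfe _
  have hdd' : d'.comp d' = 0 := by
    refine Finsupp.lhom_ext' fun j => LinearMap.ext_ring ?_
    fin_cases j <;> simp only [LinearMap.comp_apply, Finsupp.lsingle_apply, Fin.reduceFinMk,
      Fin.zero_eta, Fin.mk_one, hd'x, hd'x0, hd'x1, hd'y0, hd'y1, map_zero, map_add, map_smul,
      smul_zero, LinearMap.zero_apply]
    rw [smul_comm]
    exact add_self_eq_zero_of_module_Rfe _
  refine ⟨hdd, hdd', ?_⟩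
  intro bd t₀ t
  have hφ := constantCoeff_tensorCoeff_eq_zero d d' hd hd' 1 4
  have hφt : constantCoeff (tensorCoeff 1 4 t₀) ≠ 0 := by simp [t₀]
  have hbd (a b : Cfe) : bd (a ⊗ₜ b) = d a ⊗ₜ b + a ⊗ₜ d' b := rfl
  have ht₀ : bd t₀ = 0 := by
    rw [hbd, hdx0, hd'y1, TensorProduct.zero_tmul, TensorProduct.tmul_zero]
    exact add_zero _
  have ht : bd t = 0 := by
    simp only [t, map_add, hbd, hdx, hdx0, hdx1, hdy0, hdy1, hd'x, hd'x0, hd'x1, hd'y0, hd'y1,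
      TensorProduct.zero_tmul, TensorProduct.tmul_zero, TensorProduct.add_tmul,
      TensorProduct.tmul_add, TensorProduct.smul_tmul', TensorProduct.tmul_smul]
    simp only [zero_add, add_zero]
    exact add_cycle_eq_zero_of_module_Rfe (M := Cfe ⊗[Rfe] Cfe) _ _ _ _
  have hrange : t₀ ∉ LinearMap.range bd := by
    rintro ⟨w, hw⟩
    exact hφt (hw ▸ hφ w)
  have hquot (I : Ideal Rfe) (hI : ∀ r ∈ I, constantCoeff r = 0) :
      CycleNotBoundary (Rfe ⧸ I) bd t₀ :=
    cycleNotBoundary_quotient I hI bd (tensorCoeff 1 4) hφ t₀ ht₀ hφt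
  refine ⟨tensor_differential_comp_self d d' hdd hdd', ht₀, hrange,
    hquot _ (constantCoeff_eq_zero_of_mem_span (by simp)),
    hquot _ (constantCoeff_eq_zero_of_mem_span (by simp)),
    hquot _ (constantCoeff_eq_zero_of_mem_span (by simp)), ht, ?_, ?_⟩
  · rw [map_add, ht, ht₀]
    exact add_zero _
  · have h : t + t₀ - t = t₀ := add_sub_cancel_left t t₀
    rwa [h]
end
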